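/- (Null space of the energy Hessian.) Assume the Jellium and Wiener conditions. Then B(φ,κ,p) = 0 if and only if φ is a constant function, κ is constant (κ(n) = s for some s ∈ ℝ³ and all n), and p ≡ 0. -/

import Mathlib

noncomputable section

namespace SPN

open MeasureTheory Finset
open scoped Real

/-- Points of `ℝ³`. -/
abbrev V3 : Type := Fin 3 → ℝ

/-- Euclidean dot product on `ℝ³`. -/
def dotP (v w : V3) : ℝ := ∑ i, v i * w i

/-- Squared Euclidean norm on `ℝ³`. -/
def nsqV (v : V3) : ℝ := ∑ i, v i ^ 2

/-- The fundamental cube `[0,N)³` of the torus `T_N = ℝ³/(N·ℤ³)`. -/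
def cubeN (N : ℕ) : Set V3 := {x | ∀ i, x i ∈ Set.Ico (0 : ℝ) (N : ℝ)}

/-- `N·ℤ³`-periodicity of a function on `ℝ³`. -/
def IsPerN {α : Type*} (N : ℕ) (f : V3 → α) : Prop :=
  ∀ (x : V3) (k : Fin 3 → ℤ), f (x + fun i => (N : ℝ) * (k i : ℝ)) = f x

/-- Index set for `Γ_N = {0,…,N−1}³`. -/
abbrev GammaIdx (N : ℕ) : Type := Fin 3 → Fin N

/-- The lattice point of `Γ_N` associated to an index. -/
def embG {N : ℕ} (n : GammaIdx N) : V3 := fun i => ((n i : ℕ) : ℝ)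

/-- Fourier coefficient `f̂(ξ) = ∫_{T_N} e^{iξ·x} f(x) dx`. -/
def fCoeff (N : ℕ) (f : V3 → ℂ) (ξ : V3) : ℂ :=
  ∫ x in cubeN N, Complex.exp (Complex.I * ((dotP ξ x : ℝ) : ℂ)) * f x

/-- Fourier coefficient of a real-valued function. -/
def fCoeffR (N : ℕ) (f : V3 → ℝ) (ξ : V3) : ℂ :=
  fCoeff N (fun x => ((f x : ℝ) : ℂ)) ξ

/-- The point `(2π/N)·k` of the dual lattice `Γ*_N`. -/
def xiN (N : ℕ) (k : Fin 3 → ℤ) : V3 := fun i => (2 * π / (N : ℝ)) * (k i : ℝ)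

/-- The Jellium condition: `σ̂(ξ) = 0` for all `ξ ∈ Γ*_1 \ {0}`. -/
def JelliumCond (N : ℕ) (σ : V3 → ℝ) : Prop :=
  ∀ k : Fin 3 → ℤ, k ≠ 0 → fCoeffR N σ (fun i => 2 * π * (k i : ℝ)) = 0

/-- `(2π/N)·k ∈ Γ*_1`, i.e. every coordinate of `k` is divisible by `N`. -/
def inGamma1 (N : ℕ) (k : Fin 3 → ℤ) : Prop := ∀ i, (N : ℤ) ∣ k i

/-- `|∇φ(x)|²` for a complex-valued function. -/
def gradSq (φ : V3 → ℂ) (x : V3) : ℝ :=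
  ∑ i, Complex.normSq (fderiv ℝ φ x (Pi.single i 1))

/-- Gradient of a real-valued function on `ℝ³`. -/
def gradV (f : V3 → ℝ) (x : V3) : V3 := fun i => fderiv ℝ f x (Pi.single i 1)

/-- Total charge density `ρ(x) = ∑_n σ(x−n−q(n)) − e|ψ(x)|²`. -/
def rhoT (N : ℕ) (σ : V3 → ℝ) (e : ℝ) (ψ : V3 → ℂ) (q : GammaIdx N → V3) (x : V3) : ℝ :=
  (∑ n : GammaIdx N, σ (x - embG n - q n)) - e * Complex.normSq (ψ x)

/-- `∑_{ξ∈Γ*_N\{0}} |f̂(ξ)|²/|ξ|²`. -/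
def dualSum (N : ℕ) (f : V3 → ℝ) : ℝ :=
  ∑' k : Fin 3 → ℤ, if k = 0 then 0 else
    Complex.normSq (fCoeffR N f (xiN N k)) / nsqV (xiN N k)

/-- The energy functional `E(ψ,q,p)`. -/
def energyE (N : ℕ) (σ : V3 → ℝ) (e M : ℝ) (ψ : V3 → ℂ) (q p : GammaIdx N → V3) : ℝ :=
  (1 / 2) * (∫ x in cubeN N, gradSq ψ x)
    + (2 * (N : ℝ) ^ 3)⁻¹ * dualSum N (rhoT N σ e ψ q)
    + (2 * M)⁻¹ * ∑ n : GammaIdx N, nsqV (p n)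

/-- The matrix `Σ(θ) = ∑_{m∈ℤ³} (ξξᵀ/|ξ|²)|σ̂(ξ)|²`, `ξ = θ + 2πm`. -/
def SigMat (N : ℕ) (σ : V3 → ℝ) (θ : V3) : Matrix (Fin 3) (Fin 3) ℝ :=
  Matrix.of fun a b => ∑' m : Fin 3 → ℤ,
    ((θ a + 2 * π * (m a : ℝ)) * (θ b + 2 * π * (m b : ℝ))
        / nsqV (fun i => θ i + 2 * π * (m i : ℝ)))
      * Complex.normSq (fCoeffR N σ (fun i => θ i + 2 * π * (m i : ℝ)))

/-- The Wiener condition: `Σ(θ)` is positive definite for all `θ ∈ Γ*_N \ Γ*_1`. -/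
def WienerCond (N : ℕ) (σ : V3 → ℝ) : Prop :=
  ∀ k : Fin 3 → ℤ, ¬ inGamma1 N k → (SigMat N σ (xiN N k)).PosDef

/-- First-order ionic density `σ⁽¹⁾(x) = −∑_n κ(n)·∇σ(x−n−r)`. -/
def sigma1F (N : ℕ) (σ : V3 → ℝ) (r : V3) (κ : GammaIdx N → V3) (x : V3) : ℝ :=
  - ∑ n : GammaIdx N, dotP (κ n) (gradV σ (x - embG n - r))

/-- First-order charge density `ρ⁽¹⁾(x) = σ⁽¹⁾(x) − 2e√Z·Re(e^{−iα}φ(x))`. -/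
def rho1F (N : ℕ) (σ : V3 → ℝ) (e Z α : ℝ) (r : V3) (κ : GammaIdx N → V3)
    (φ : V3 → ℂ) (x : V3) : ℝ :=
  sigma1F N σ r κ x - 2 * e * Real.sqrt Z * (Complex.exp (-Complex.I * (α : ℂ)) * φ x).re

/-- The quadratic form `B(φ,κ,p)` (half of the energy Hessian). -/
def BformQ (N : ℕ) (σ : V3 → ℝ) (e Z M α : ℝ) (r : V3)
    (φ : V3 → ℂ) (κ p : GammaIdx N → V3) : ℝ :=
  (1 / 2) * (∫ x in cubeN N, gradSq φ x)
    + (2 * (N : ℝ) ^ 3)⁻¹ * dualSum N (rho1F N σ e Z α r κ φ)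
    + (2 * M)⁻¹ * ∑ n : GammaIdx N, nsqV (p n)

/-- Second-order charge density `ρ⁽²⁾`. -/
def rho2F (N : ℕ) (σ : V3 → ℝ) (e : ℝ) (r : V3) (κ : GammaIdx N → V3)
    (φ : V3 → ℂ) (x : V3) : ℝ :=
  (∑ n : GammaIdx N,
      (σ (x - embG n - r - κ n) - σ (x - embG n - r)
        + dotP (κ n) (gradV σ (x - embG n - r))))
    - e * Complex.normSq (φ x)

/-- The pairing `(f, Gg) = N⁻³ ∑_{ξ∈Γ*_N\{0}} Re(f̂(ξ)·conj(ĝ(ξ)))/|ξ|²`. -/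
def GPair (N : ℕ) (f g : V3 → ℝ) : ℝ :=
  ((N : ℝ) ^ 3)⁻¹ * ∑' k : Fin 3 → ℤ, if k = 0 then 0 else
    (fCoeffR N f (xiN N k) * (starRingEnd ℂ) (fCoeffR N g (xiN N k))).re / nsqV (xiN N k)

/-- The distance to the solitary manifold of ground states. -/
def distS (N : ℕ) (Z : ℝ) (ψ : V3 → ℂ) (q p : GammaIdx N → V3) : ℝ :=
  ⨅ (α : ℝ) (r : V3),
    (Real.sqrt (∫ x in cubeN N,
        (Complex.normSq (ψ x - Complex.exp (Complex.I * (α : ℂ)) * ((Real.sqrt Z : ℝ) : ℂ))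
          + gradSq ψ x))
      + Real.sqrt (∑ n : GammaIdx N, ⨅ k : Fin 3 → ℤ,
          nsqV (fun i => q n i - r i - (N : ℝ) * (k i : ℝ)))
      + Real.sqrt (∑ n : GammaIdx N, nsqV (p n)))

/-- The discrete Fourier transform `κ̂(θ) ∈ ℂ³` of `κ : Γ_N → ℝ³`. -/
def hatK (N : ℕ) (κ : GammaIdx N → V3) (θ : V3) (a : Fin 3) : ℂ :=
  ∑ n : GammaIdx N, Complex.exp (Complex.I * ((dotP θ (embG n) : ℝ) : ℂ)) * ((κ n a : ℝ) : ℂ)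

/-- Laplacian of a complex-valued function on `ℝ³`. -/
def lapC (f : V3 → ℂ) (x : V3) : ℂ :=
  ∑ i, fderiv ℝ (fun y => fderiv ℝ f y (Pi.single i 1)) x (Pi.single i 1)

/-- Laplacian of a real-valued function on `ℝ³`. -/
def lapR (f : V3 → ℝ) (x : V3) : ℝ :=
  ∑ i, fderiv ℝ (fun y => fderiv ℝ f y (Pi.single i 1)) x (Pi.single i 1)

/-- A classical solution of the Schrödinger–Poisson–Newton system on `ℝ`. -/
structure IsSPN (N : ℕ) (σ : V3 → ℝ) (e M : ℝ)
    (ψ : V3 → ℝ → ℂ) (Φ : V3 → ℝ → ℝ) (q : ℝ → GammaIdx N → V3) : Prop where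
  per_psi : ∀ t : ℝ, IsPerN N (fun x => ψ x t)
  per_Phi : ∀ t : ℝ, IsPerN N (fun x => Φ x t)
  regx_psi : ∀ t : ℝ, ContDiff ℝ 2 (fun x => ψ x t)
  regt_psi : ∀ x : V3, ContDiff ℝ 1 (fun t => ψ x t)
  regx_Phi : ∀ t : ℝ, ContDiff ℝ 2 (fun x => Φ x t)
  regt_Phi : ∀ x : V3, ContDiff ℝ 1 (fun t => Φ x t)
  reg_q : ContDiff ℝ 2 q
  schrodinger : ∀ (x : V3) (t : ℝ),
    Complex.I * deriv (fun s => ψ x s) t =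
      -(1 / 2 : ℂ) * lapC (fun y => ψ y t) x - ((e : ℝ) : ℂ) * ((Φ x t : ℝ) : ℂ) * ψ x t
  poisson : ∀ (x : V3) (t : ℝ),
    - lapR (fun y => Φ y t) x =
      (∑ n : GammaIdx N, σ (x - embG n - q t n)) - e * Complex.normSq (ψ x t)
  newton : ∀ (n : GammaIdx N) (t : ℝ) (i : Fin 3),
    M * deriv (fun s => deriv (fun u => q u n i) s) t =
      - ∫ x in cubeN N, fderiv ℝ (fun y => Φ y t) x (Pi.single i 1) * σ (x - embG n - q t n)


/-- The plane wave. -/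
def ex (ξ x : V3) : ℂ := Complex.exp (Complex.I * ((dotP ξ x : ℝ) : ℂ))

lemma ex_add (ξ x y : V3) : ex ξ (x + y) = ex ξ x * ex ξ y := by
  unfold ex; rw [← Complex.exp_add]; congr 1
  simp only [dotP, Pi.add_apply, Fin.sum_univ_three]; push_cast; ring

lemma ex_add_left (ξ η x : V3) : ex (ξ + η) x = ex ξ x * ex η x := by
  unfold ex; rw [← Complex.exp_add]; congr 1
  simp only [dotP, Pi.add_apply, Fin.sum_univ_three]; push_cast; ring

lemma ex_ne (ξ x : V3) : ex ξ x ≠ 0 := Complex.exp_ne_zero _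

lemma ex_neg_left (ξ x : V3) : ex (-ξ) x = (starRingEnd ℂ) (ex ξ x) := by
  unfold ex; rw [← Complex.exp_conj]; congr 1
  simp [dotP, Finset.sum_neg_distrib]

lemma norm_ex (ξ x : V3) : ‖ex ξ x‖ = 1 := by
  unfold ex; rw [mul_comm]; exact Complex.norm_exp_ofReal_mul_I _

lemma contDiff_ex (ξ : V3) : ContDiff ℝ 2 (ex ξ) := by
  have hi : ∀ i : Fin 3, ContDiff ℝ 2 (fun x : V3 => x i) := fun i => contDiff_apply ℝ ℝ i
  have hd : ContDiff ℝ 2 (fun x : V3 => dotP ξ x) :=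
    ContDiff.sum (f := fun (i : Fin 3) (x : V3) => ξ i * x i)
      fun i _ => contDiff_const.mul (hi i)
  unfold ex
  exact (contDiff_const.mul (Complex.ofRealCLM.contDiff.comp hd)).cexp

lemma cont_ex (ξ : V3) : Continuous (ex ξ) := (contDiff_ex ξ).continuous

lemma ex_int (N : ℕ) (hN : 0 < N) (k m : Fin 3 → ℤ) :
    ex (xiN N k) (fun i => (N : ℝ) * (m i : ℝ)) = 1 := by
  unfold ex
  rw [Complex.exp_eq_one_iff]
  refine ⟨∑ i, k i * m i, ?_⟩
  have : (N : ℂ) ≠ 0 := by exact_mod_cast hN.ne'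
  simp only [dotP, xiN, Fin.sum_univ_three]
  push_cast
  field_simp

lemma cube_eq (N : ℕ) : cubeN N = Set.univ.pi (fun _ : Fin 3 => Set.Ico (0:ℝ) (N:ℝ)) := by
  ext x; simp [cubeN]

lemma cube_restrict (N : ℕ) : (volume : Measure V3).restrict (cubeN N) =
    Measure.pi (fun _ : Fin 3 => (volume : Measure ℝ).restrict (Set.Ico (0:ℝ) (N:ℝ))) := by
  rw [cube_eq, volume_pi, Measure.restrict_pi_pi]

lemma cube_subset (N : ℕ) : cubeN N ⊆ Set.Icc (fun _ => (0:ℝ)) (fun _ => (N:ℝ)) := by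
  intro x hx
  exact ⟨fun i => (hx i).1, fun i => (hx i).2.le⟩

lemma cube_ae (N : ℕ) : cubeN N =ᵐ[volume]
    (Set.Icc (fun _ => (0:ℝ)) (fun _ => (N:ℝ)) : Set V3) := by
  rw [cube_eq, volume_pi]
  exact Measure.univ_pi_Ico_ae_eq_Icc

lemma meas_cube (N : ℕ) : MeasurableSet (cubeN N) := by
  rw [cube_eq]; exact MeasurableSet.univ_pi fun _ => measurableSet_Ico

instance finCube (N : ℕ) : IsFiniteMeasure ((volume : Measure V3).restrict (cubeN N)) := by
  constructor
  rw [Measure.restrict_apply_univ]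
  exact lt_of_le_of_lt (measure_mono (cube_subset N)) isCompact_Icc.measure_lt_top

lemma intOn {E : Type*} [NormedAddCommGroup E] (N : ℕ) {f : V3 → E} (hf : Continuous f) :
    IntegrableOn f (cubeN N) :=
  (hf.continuousOn.integrableOn_compact isCompact_Icc).mono_set (cube_subset N)

lemma memLpOn (N : ℕ) {f : V3 → ℂ} (hf : Continuous f) :
    MemLp f 2 ((volume : Measure V3).restrict (cubeN N)) := by
  obtain ⟨C, hC⟩ := (isCompact_Icc (a := (fun _ => (0:ℝ) : V3))
    (b := fun _ => (N:ℝ))).exists_bound_of_continuousOn hf.continuousOn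
  refine MemLp.of_bound hf.aestronglyMeasurable C ?_
  filter_upwards [ae_restrict_mem (meas_cube N)] with x hx
  exact hC x (cube_subset N hx)

lemma int1 (N : ℕ) (hN : 0 < N) (k : ℤ) :
    ∫ x in Set.Ico (0:ℝ) (N:ℝ), Complex.exp (Complex.I * (((2 * π / (N : ℝ)) * (k : ℝ)) * x : ℝ))
      = if k = 0 then (N:ℂ) else 0 := by
  have hN' : (N : ℂ) ≠ 0 := by exact_mod_cast hN.ne'
  rw [integral_Ico_eq_integral_Ioo, ← integral_Ioc_eq_integral_Ioo,
    ← intervalIntegral.integral_of_le (by positivity)]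
  split_ifs with h
  · simp [h]
  · have hc : (Complex.I * (2 * π / N * k) : ℂ) ≠ 0 := by
      have : (k:ℂ) ≠ 0 := by exact_mod_cast h
      have : (π:ℂ) ≠ 0 := by exact_mod_cast Real.pi_ne_zero
      simp [*]
    have := integral_exp_mul_complex (a := 0) (b := N) hc
    rw [show (fun x : ℝ => Complex.exp (Complex.I * (((2 * π / (N : ℝ)) * (k : ℝ)) * x : ℝ)))
      = fun x : ℝ => Complex.exp ((Complex.I * (2 * π / N * k) : ℂ) * x) by
        ext x; congr 1; push_cast; ring]
    rw [this]
    have h1 : Complex.exp (Complex.I * (2 * π / N * k) * ((N:ℝ):ℂ)) = 1 := by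
      rw [Complex.exp_eq_one_iff]
      refine ⟨k, ?_⟩
      push_cast; field_simp
    rw [h1]; simp

lemma int_ex (N : ℕ) (hN : 0 < N) (k : Fin 3 → ℤ) :
    ∫ x in cubeN N, ex (xiN N k) x = if k = 0 then (N:ℂ)^3 else 0 := by
  rw [cube_restrict]
  have : ∀ x : V3, ex (xiN N k) x =
      ∏ i, Complex.exp (Complex.I * (((2 * π / (N : ℝ)) * (k i : ℝ)) * x i : ℝ)) := by
    intro x
    rw [← Complex.exp_sum, ← Finset.mul_sum]
    simp [ex, dotP, xiN]
  simp_rw [this]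
  rw [integral_fintype_prod_eq_prod
    (fun i (y : ℝ) => Complex.exp (Complex.I * (((2 * π / (N : ℝ)) * (k i : ℝ)) * y : ℝ)))]
  simp_rw [int1 N hN]
  split_ifs with h
  · simp [h]
  · obtain ⟨i, hi⟩ := Function.ne_iff.1 h
    exact Finset.prod_eq_zero (Finset.mem_univ i) (if_neg (by simpa using hi))

lemma bessel (N : ℕ) (hN : 0 < N) {f : V3 → ℂ} (hf : Continuous f) :
    Summable fun k : Fin 3 → ℤ => Complex.normSq (fCoeff N f (xiN N k)) := by
  have hN' : (N : ℂ) ≠ 0 := by exact_mod_cast hN.ne'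
  have hNr : (0 : ℝ) < N := by exact_mod_cast hN
  set μ := (volume : Measure V3).restrict (cubeN N) with hμ
  set c : ℝ := (Real.sqrt ((N:ℝ)^3))⁻¹ with hc
  have hc2 : c * c * (N:ℝ)^3 = 1 := by
    rw [hc, ← mul_inv, Real.mul_self_sqrt (by positivity)]
    field_simp
  have hc0 : c ≠ 0 := by rw [hc]; positivity
  have hcont : ∀ k : Fin 3 → ℤ, Continuous (fun x => (c:ℂ) * ex (-xiN N k) x) :=
    fun k => continuous_const.mul (cont_ex _)
  let v : (Fin 3 → ℤ) → Lp ℂ 2 μ := fun k => (memLpOn N (hcont k)).toLp _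
  have hin : ∀ (k : Fin 3 → ℤ) (g : V3 → ℂ) (hg : MemLp g 2 μ),
      inner ℂ (v k) (hg.toLp g) = (c:ℂ) * ∫ x, ex (xiN N k) x * g x ∂μ := by
    intro k g hg
    rw [L2.inner_def, ← integral_const_mul]
    apply integral_congr_ae
    filter_upwards [(memLpOn N (hcont k)).coeFn_toLp, hg.coeFn_toLp] with x h1 h2
    rw [show (v k) x = _ from h1, h2, RCLike.inner_apply]
    rw [map_mul, ← ex_neg_left]
    simp; ring
  have ho : Orthonormal ℂ v := by
    rw [orthonormal_iff_ite]
    intro k l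
    rw [show v l = (memLpOn N (hcont l)).toLp _ from rfl, hin]
    have : ∀ x, ex (xiN N k) x * ((c:ℂ) * ex (-xiN N l) x) = (c:ℂ) * ex (xiN N (k - l)) x := by
      intro x
      rw [show xiN N (k - l) = xiN N k + -xiN N l by
        ext i; simp [xiN]; ring, ex_add_left]; ring
    simp_rw [this]
    rw [integral_const_mul, int_ex N hN, ← mul_assoc]
    simp only [sub_eq_zero]
    split_ifs
    · exact_mod_cast hc2
    · simp
  have hs := ho.inner_products_summable (x := (memLpOn N hf).toLp f)
  simp_rw [hin, norm_mul, mul_pow] at hs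
  rw [summable_mul_left_iff (by simp [hc0])] at hs
  refine hs.congr fun k => ?_
  rw [Complex.normSq_eq_norm_sq]; rfl

/-- The lattice `N ℤ³`. -/
def latN (N : ℕ) : AddSubgroup V3 :=
  AddMonoidHom.range (AddMonoidHom.mk' (fun k : Fin 3 → ℤ => (fun i => (N : ℝ) * (k i : ℝ) : V3))
    (by intro a b; ext i; simp; ring))

instance countLat (N : ℕ) : Countable (latN N) := by
  unfold latN
  exact Set.countable_range _

lemma fundDom (N : ℕ) (hN : 0 < N) (a : V3) :
    IsAddFundamentalDomain (latN N) {x : V3 | x + a ∈ cubeN N} volume := by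
  have hNr : (0 : ℝ) < N := by exact_mod_cast hN
  apply IsAddFundamentalDomain.mk'
  · exact ((meas_cube N).preimage (measurable_add_const a)).nullMeasurableSet
  · intro x
    have h := fun i => existsUnique_add_zsmul_mem_Ico hNr (x i + a i) 0
    choose m hm hu using h
    refine ⟨⟨fun i => (N : ℝ) * (m i : ℝ), ⟨m, rfl⟩⟩, ?_, ?_⟩
    · intro i
      have := hm i
      simp only [zsmul_eq_mul, zero_add] at this
      simp only [AddSubgroup.vadd_def, vadd_eq_add, Pi.add_apply]
      convert this using 1; ring
    · rintro ⟨g, ⟨k, rfl⟩⟩ hg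
      have : k = m := by
        ext i
        apply hu i
        have := hg i
        simp only [AddSubgroup.vadd_def, vadd_eq_add, Pi.add_apply] at this
        simp only [zsmul_eq_mul, zero_add]
        convert this using 1
        simp; ring
      subst this; rfl

lemma int_shift (N : ℕ) (hN : 0 < N) {f : V3 → ℂ} (hf : IsPerN N f) (a : V3) :
    ∫ x in cubeN N, f (x - a) = ∫ x in cubeN N, f x := by
  have h1 := (measurePreserving_sub_right (volume : Measure V3) a).setIntegral_preimage_emb
    (MeasurableEquiv.subRight a).measurableEmbedding f {x : V3 | x + a ∈ cubeN N}
  have h2 : (fun x => x - a) ⁻¹' {x : V3 | x + a ∈ cubeN N} = cubeN N := by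
    ext x; simp
  rw [h2] at h1
  rw [h1]
  have h3 := fundDom N hN 0
  simp only [add_zero, Set.ofPred_mem_eq] at h3
  refine (fundDom N hN a).setIntegral_eq h3 ?_
  rintro ⟨g, ⟨k, rfl⟩⟩ x
  have := hf x k
  rw [add_comm] at this
  exact this

lemma int_deriv (N : ℕ) {g : V3 → ℂ} (hg : ContDiff ℝ 1 g) (hp : IsPerN N g) (j : Fin 3) :
    ∫ x in cubeN N, fderiv ℝ g x (Pi.single j 1) = 0 := by
  rw [setIntegral_congr_set (cube_ae N)]
  have hle : (fun _ => (0:ℝ) : V3) ≤ (fun _ => (N:ℝ)) := fun i => by positivity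
  have hcd : Continuous fun x => fderiv ℝ g x (Pi.single j 1) :=
    (hg.continuous_fderiv (by norm_num)).clm_apply continuous_const
  have hsum : ∀ x, (∑ i : Fin 3, (if i = j then fderiv ℝ g x else 0) (Pi.single i 1)) =
      fderiv ℝ g x (Pi.single j 1) := by
    intro x
    rw [Finset.sum_eq_single j]
    · simp
    · intro b _ hb; simp [hb]
    · simp
  have := integral_divergence_of_hasFDerivAt_off_countable' (n := 2) (fun _ => (0:ℝ))
    (fun _ => (N:ℝ)) hle (fun i => if i = j then g else fun _ => 0)
    (fun i x => if i = j then fderiv ℝ g x else 0) ∅ Set.countable_empty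
    (by intro i; split_ifs
        · exact hg.continuous.continuousOn
        · exact continuousOn_const)
    (by intro x _ i; split_ifs
        · exact (hg.differentiable (by norm_num) x).hasFDerivAt
        · exact hasFDerivAt_const _ _)
    (by simp_rw [hsum]; exact hcd.continuousOn.integrableOn_compact isCompact_Icc)
  simp_rw [hsum] at this
  rw [this]
  apply Finset.sum_eq_zero
  intro i _
  split_ifs with h
  · rw [sub_eq_zero]
    congr 1
    ext x
    rw [← hp (Fin.insertNth i 0 x) (Pi.single i 1)]
    congr 1
    ext l
    refine Fin.succAboveCases i ?_ (fun l => ?_) l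
    · simp
    · simp
  · simp

lemma per_fderiv {E : Type*} [NormedAddCommGroup E] [NormedSpace ℝ E] (N : ℕ) {g : V3 → E}
    (hp : IsPerN N g) : IsPerN N (fderiv ℝ g) := by
  intro x k
  rw [← fderiv_comp_add_right]
  congr 1
  ext y
  exact hp y k

lemma ex_per (N : ℕ) (hN : 0 < N) (k : Fin 3 → ℤ) : IsPerN N (ex (xiN N k)) := by
  intro x m
  rw [ex_add, ex_int N hN, mul_one]

lemma fderiv_ex (ξ x : V3) (j : Fin 3) :
    fderiv ℝ (ex ξ) x (Pi.single j 1) = Complex.I * (ξ j : ℂ) * ex ξ x := by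
  have hl : HasFDerivAt (fun x : V3 => dotP ξ x)
      (∑ i, ξ i • (ContinuousLinearMap.proj i : V3 →L[ℝ] ℝ)) x := by
    unfold dotP
    exact HasFDerivAt.fun_sum fun i _ => (hasFDerivAt_apply i x).const_mul (ξ i)
  have h2 := (Complex.ofRealCLM.hasFDerivAt.comp x hl).const_mul Complex.I
  have h3 := h2.cexp
  have : fderiv ℝ (ex ξ) x = _ := h3.fderiv
  rw [this]
  simp [ex, Pi.single_apply]
  ring

lemma coeff_deriv (N : ℕ) (hN : 0 < N) {σ : V3 → ℝ} (hper : IsPerN N σ) (hreg : ContDiff ℝ 2 σ)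
    (k : Fin 3 → ℤ) (j : Fin 3) :
    ∫ x in cubeN N, ex (xiN N k) x * ((fderiv ℝ σ x (Pi.single j 1) : ℝ) : ℂ) =
      -(Complex.I * (xiN N k j : ℂ)) * fCoeffR N σ (xiN N k) := by
  have hs : ContDiff ℝ 2 (fun x => (σ x : ℂ)) := Complex.ofRealCLM.contDiff.comp hreg
  have hg : ContDiff ℝ 1 (fun x => ex (xiN N k) x * (σ x : ℂ)) :=
    ((contDiff_ex _).mul hs).of_le (by norm_num)
  have h0 := int_deriv N hg (by
    intro x m
    show _ * _ = _ * _
    rw [ex_per N hN, hper]) j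
  have hσ : ∀ x, HasFDerivAt (fun x => (σ x : ℂ)) (Complex.ofRealCLM.comp (fderiv ℝ σ x)) x :=
    fun x => Complex.ofRealCLM.hasFDerivAt.comp x (hreg.differentiable (by norm_num) x).hasFDerivAt
  have hd : ∀ x, fderiv ℝ (fun x => ex (xiN N k) x * (σ x : ℂ)) x (Pi.single j 1) =
      ex (xiN N k) x * ((fderiv ℝ σ x (Pi.single j 1) : ℝ) : ℂ) +
      (Complex.I * (xiN N k j : ℂ)) * (ex (xiN N k) x * (σ x : ℂ)) := by
    intro x
    have := (((contDiff_ex (xiN N k)).differentiable (by norm_num) x).hasFDerivAt.mul (hσ x)).fderiv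
    erw [this]
    simp [fderiv_ex]
    ring
  simp_rw [hd] at h0
  have hc : Continuous fun x => fderiv ℝ σ x (Pi.single j 1) :=
    (hreg.continuous_fderiv (by norm_num)).clm_apply continuous_const
  rw [integral_add, integral_const_mul] at h0
  · rw [eq_comm, neg_mul, neg_eq_iff_add_eq_zero, add_comm]
    exact h0
  · exact intOn N ((cont_ex _).mul (Complex.continuous_ofReal.comp hc))
  · exact intOn N (continuous_const.mul hg.continuous)

lemma coeff_deriv_shift (N : ℕ) (hN : 0 < N) {σ : V3 → ℝ} (hper : IsPerN N σ)
    (hreg : ContDiff ℝ 2 σ) (k : Fin 3 → ℤ) (j : Fin 3) (a : V3) :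
    ∫ x in cubeN N, ex (xiN N k) x * ((fderiv ℝ σ (x - a) (Pi.single j 1) : ℝ) : ℂ) =
      ex (xiN N k) a * (-(Complex.I * (xiN N k j : ℂ)) * fCoeffR N σ (xiN N k)) := by
  rw [← coeff_deriv N hN hper hreg]
  rw [← int_shift N hN (f := fun x => ex (xiN N k) x *
    ((fderiv ℝ σ x (Pi.single j 1) : ℝ) : ℂ)) (a := a), ← integral_const_mul]
  · congr 1
    ext x
    have : ex (xiN N k) x = ex (xiN N k) a * ex (xiN N k) (x - a) := by
      rw [← ex_add]; congr 1; abel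
    rw [this]; ring
  · intro x m
    show _ * _ = _ * _
    rw [ex_per N hN, per_fderiv N hper]

lemma cont_grad {σ : V3 → ℝ} (hreg : ContDiff ℝ 2 σ) (j : Fin 3) (a : V3) :
    Continuous fun x => fderiv ℝ σ (x - a) (Pi.single j 1) :=
  ((hreg.continuous_fderiv (by norm_num)).comp (by fun_prop)).clm_apply continuous_const

lemma cont_sigma1 (N : ℕ) {σ : V3 → ℝ} (hreg : ContDiff ℝ 2 σ) (r : V3) (κ : GammaIdx N → V3) :
    Continuous (sigma1F N σ r κ) := by
  unfold sigma1F dotP gradV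
  refine (continuous_finsetSum _ fun n _ => continuous_finsetSum _ fun i _ => ?_).neg
  simp_rw [sub_sub]
  exact continuous_const.mul (cont_grad hreg i _)

lemma coeff_sigma1 (N : ℕ) (hN : 0 < N) {σ : V3 → ℝ} (hper : IsPerN N σ)
    (hreg : ContDiff ℝ 2 σ) (r : V3) (κ : GammaIdx N → V3) (k : Fin 3 → ℤ) :
    fCoeffR N (sigma1F N σ r κ) (xiN N k) = Complex.I * ex (xiN N k) r *
      ((∑ a, (xiN N k a : ℂ) * hatK N κ (xiN N k) a) * fCoeffR N σ (xiN N k)) := by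
  have h1 : ∀ x, ex (xiN N k) x * ((sigma1F N σ r κ x : ℝ) : ℂ) =
      ∑ n : GammaIdx N, ∑ a : Fin 3, (-(κ n a : ℂ)) * (ex (xiN N k) x *
        ((fderiv ℝ σ (x - (embG n + r)) (Pi.single a 1) : ℝ) : ℂ)) := by
    intro x
    simp only [sigma1F, dotP, gradV, sub_sub]
    push_cast
    rw [mul_neg, Finset.mul_sum, ← Finset.sum_neg_distrib]
    refine Finset.sum_congr rfl fun n _ => ?_
    rw [Finset.mul_sum, ← Finset.sum_neg_distrib]
    refine Finset.sum_congr rfl fun n _ => ?_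
    ring
  have hi : ∀ (n : GammaIdx N) (a : Fin 3), IntegrableOn (fun x => (-(κ n a : ℂ)) * (ex (xiN N k) x *
        ((fderiv ℝ σ (x - (embG n + r)) (Pi.single a 1) : ℝ) : ℂ))) (cubeN N) := by
    intro n a
    exact intOn N (continuous_const.mul ((cont_ex _).mul
      (Complex.continuous_ofReal.comp (cont_grad hreg a _))))
  show ∫ x in cubeN N, ex (xiN N k) x * ((sigma1F N σ r κ x : ℝ) : ℂ) = _
  simp_rw [h1]
  rw [integral_finsetSum _ fun n _ => integrable_finsetSum _ fun a _ => hi n a]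
  simp_rw [integral_finsetSum _ fun a _ => hi _ a, integral_const_mul,
    coeff_deriv_shift N hN hper hreg]
  unfold hatK
  rw [Finset.sum_comm, Finset.sum_mul, Finset.mul_sum]
  refine Finset.sum_congr rfl fun a _ => ?_
  rw [Finset.mul_sum, Finset.sum_mul, Finset.mul_sum]
  refine Finset.sum_congr rfl fun n _ => ?_
  rw [ex_add]
  unfold ex
  ring

lemma coeff_rho1 (N : ℕ) (hN : 0 < N) {σ : V3 → ℝ} (hper : IsPerN N σ)
    (hreg : ContDiff ℝ 2 σ) (e Z α : ℝ) (r : V3) (κ : GammaIdx N → V3) (c : ℂ) (φ : V3 → ℂ)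
    (hφ : ∀ x, φ x = c) (k : Fin 3 → ℤ) (hk : k ≠ 0) :
    fCoeffR N (rho1F N σ e Z α r κ φ) (xiN N k) = Complex.I * ex (xiN N k) r *
      ((∑ a, (xiN N k a : ℂ) * hatK N κ (xiN N k) a) * fCoeffR N σ (xiN N k)) := by
  rw [← coeff_sigma1 N hN hper hreg]
  show ∫ x in cubeN N, ex (xiN N k) x * ((rho1F N σ e Z α r κ φ x : ℝ) : ℂ) =
    ∫ x in cubeN N, ex (xiN N k) x * ((sigma1F N σ r κ x : ℝ) : ℂ)
  simp only [rho1F, hφ]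
  set d : ℝ := 2 * e * Real.sqrt Z * (Complex.exp (-Complex.I * (α : ℂ)) * c).re
  have : ∀ x, ex (xiN N k) x * ((sigma1F N σ r κ x - d : ℝ) : ℂ) =
      ex (xiN N k) x * ((sigma1F N σ r κ x : ℝ) : ℂ) - d * ex (xiN N k) x := by
    intro x; push_cast; ring
  simp_rw [this]
  rw [integral_sub, integral_const_mul, int_ex N hN, if_neg hk, mul_zero, sub_zero]
  · exact intOn N ((cont_ex _).mul (Complex.continuous_ofReal.comp (cont_sigma1 N hreg r κ)))
  · exact intOn N (continuous_const.mul (cont_ex _))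

lemma geo1 (N : ℕ) (hN : 0 < N) (j : ℤ) :
    ∑ n : Fin N, Complex.exp (Complex.I * (((2 * π / (N : ℝ)) * (j : ℝ)) * ((n : ℕ) : ℝ) : ℝ)) =
      if (N : ℤ) ∣ j then (N : ℂ) else 0 := by
  have hN' : (N : ℂ) ≠ 0 := by exact_mod_cast hN.ne'
  set z : ℂ := Complex.exp (2 * π * Complex.I * (j / N)) with hz
  have h1 : ∀ n : ℕ, Complex.exp (Complex.I * (((2 * π / (N : ℝ)) * (j : ℝ)) * (n : ℝ) : ℝ))
      = z ^ n := by
    intro n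
    rw [hz, ← Complex.exp_nat_mul]; congr 1; push_cast; ring
  simp_rw [h1]
  rw [Fin.sum_univ_eq_sum_range (fun n => z ^ n)]
  have hzN : z ^ N = 1 := by
    rw [hz, ← Complex.exp_nat_mul, Complex.exp_eq_one_iff]
    exact ⟨j, by field_simp⟩
  have hz1 : z = 1 ↔ (N : ℤ) ∣ j := by
    rw [hz, Complex.exp_eq_one_iff]
    constructor
    · rintro ⟨m, hm⟩
      refine ⟨m, ?_⟩
      have hpi : (2 * π * Complex.I : ℂ) ≠ 0 := Complex.two_pi_I_ne_zero
      rw [mul_comm (m:ℂ)] at hm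
      have := mul_left_cancel₀ hpi hm
      field_simp at this
      exact_mod_cast this
    · rintro ⟨m, rfl⟩
      exact ⟨m, by push_cast; field_simp⟩
  split_ifs with h
  · rw [hz1.2 h]; simp
  · rw [geom_sum_eq (fun h' => h (hz1.1 h')), hzN]; simp

open Classical in
lemma dsum (N : ℕ) (hN : 0 < N) (j : Fin 3 → ℤ) :
    ∑ n : GammaIdx N, ex (xiN N j) (embG n) = if inGamma1 N j then (N : ℂ) ^ 3 else 0 := by
  have : ∀ n : GammaIdx N, ex (xiN N j) (embG n) =
      ∏ i, Complex.exp (Complex.I * (((2 * π / (N : ℝ)) * (j i : ℝ)) * ((n i : ℕ) : ℝ) : ℝ)) := by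
    intro x
    rw [← Complex.exp_sum, ← Finset.mul_sum]
    simp [ex, dotP, xiN, embG]
  simp_rw [this]
  have h2 := Finset.prod_univ_sum (fun _ : Fin 3 => (Finset.univ : Finset (Fin N)))
    (fun i n => Complex.exp (Complex.I * (((2 * π / (N : ℝ)) * (j i : ℝ)) * ((n : ℕ) : ℝ) : ℝ)))
  rw [Fintype.piFinset_univ] at h2
  rw [← h2]
  simp_rw [geo1 N hN]
  split_ifs with h
  · rw [Finset.prod_congr rfl (fun i _ => if_pos (h i))]; simp
  · simp only [inGamma1, not_forall] at h
    obtain ⟨i, hi⟩ := h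
    exact Finset.prod_eq_zero (Finset.mem_univ i) (if_neg hi)

/-- Integer coordinates of an index. -/
def idxZ {N : ℕ} (n : GammaIdx N) : Fin 3 → ℤ := fun i => ((n i : ℕ) : ℤ)

lemma inG_idx {N : ℕ} (m n : GammaIdx N) : inGamma1 N (idxZ m - idxZ n) ↔ m = n := by
  constructor
  · intro h
    ext i
    have h1 := h i
    simp only [idxZ, Pi.sub_apply] at h1
    have h2 := (m i).2
    have h3 := (n i).2
    have := Int.eq_zero_of_abs_lt_dvd h1 (by rw [abs_lt]; omega)
    omega
  · rintro rfl i
    simp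

lemma hatK_const (N : ℕ) (hN : 0 < N) (κ : GammaIdx N → V3) (s : V3) (hκ : ∀ n, κ n = s)
    (k : Fin 3 → ℤ) (hk : ¬ inGamma1 N k) (a : Fin 3) : hatK N κ (xiN N k) a = 0 := by
  have := dsum N hN k
  rw [if_neg hk] at this
  simp only [hatK, hκ]
  rw [← Finset.sum_mul]
  unfold ex at this
  rw [this, zero_mul]

lemma kappa_const (N : ℕ) (hN : 0 < N) (κ : GammaIdx N → V3)
    (h : ∀ k, ¬ inGamma1 N k → ∀ a, hatK N κ (xiN N k) a = 0) (n n' : GammaIdx N) :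
    κ n = κ n' := by
  have hN' : (N : ℂ) ≠ 0 := by exact_mod_cast hN.ne'
  let l0 : GammaIdx N := fun _ => ⟨0, hN⟩
  have hl0 : idxZ l0 = 0 := by ext i; simp [idxZ, l0]
  have hsym : ∀ l m : GammaIdx N, ex (xiN N (idxZ l)) (embG m) = ex (xiN N (idxZ m)) (embG l) := by
    intro l m
    unfold ex; congr 2
    simp only [dotP, xiN, idxZ, embG]
    push_cast
    refine Finset.sum_congr rfl fun i _ => ?_
    ring
  have key : ∀ (n : GammaIdx N) (a : Fin 3), (N : ℂ) ^ 3 * (κ n a : ℂ) =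
      hatK N κ (xiN N (idxZ l0)) a := by
    intro n a
    have h1 : ∑ l : GammaIdx N, ex (xiN N (-idxZ n)) (embG l) * hatK N κ (xiN N (idxZ l)) a =
        hatK N κ (xiN N (idxZ l0)) a := by
      rw [Finset.sum_eq_single l0]
      · have : ex (xiN N (-idxZ n)) (embG l0) = 1 := by simp [ex, dotP, embG, l0]
        rw [this, one_mul]
      · intro l _ hl
        rw [h, mul_zero]
        intro hg
        apply hl
        rw [← inG_idx, hl0, sub_zero]; exact hg
      · simp
    rw [← h1]
    have h2 : ∀ l : GammaIdx N, ex (xiN N (-idxZ n)) (embG l) * hatK N κ (xiN N (idxZ l)) a =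
        ∑ m : GammaIdx N, (κ m a : ℂ) * ex (xiN N (idxZ m - idxZ n)) (embG l) := by
      intro l
      unfold hatK
      rw [Finset.mul_sum]
      refine Finset.sum_congr rfl fun m _ => ?_
      have := hsym l m
      rw [show xiN N (idxZ m - idxZ n) = xiN N (idxZ m) + xiN N (-idxZ n) by
        ext i; simp [xiN]; ring, ex_add_left, ← this]
      unfold ex; ring
    simp_rw [h2]
    rw [Finset.sum_comm]
    simp_rw [← Finset.mul_sum, dsum N hN, inG_idx]
    simp [mul_comm]
  ext a
  have := (key n a).trans (key n' a).symm
  have := mul_left_cancel₀ (pow_ne_zero 3 hN') this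
  exact_mod_cast this

lemma xi_shift (N : ℕ) (hN : 0 < N) (k m : Fin 3 → ℤ) :
    (fun i => xiN N k i + 2 * π * (m i : ℝ)) = xiN N (fun i => k i + N * m i) := by
  have hN' : (N : ℝ) ≠ 0 := by exact_mod_cast hN.ne'
  ext i
  simp only [xiN]; push_cast; field_simp

lemma nsq_nonneg (v : V3) : 0 ≤ nsqV v := Finset.sum_nonneg fun _ _ => sq_nonneg _

lemma nsq_eq_zero {v : V3} (h : nsqV v = 0) : v = 0 := by
  ext i
  have := (Finset.sum_eq_zero_iff_of_nonneg (fun i _ => sq_nonneg (v i))).1 h i (Finset.mem_univ i)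
  simpa using this

lemma mul_le_nsq (v : V3) (a b : Fin 3) : |v a * v b| ≤ nsqV v := by
  have ha : v a ^ 2 ≤ nsqV v :=
    Finset.single_le_sum (f := fun i => v i ^ 2) (fun i _ => sq_nonneg _) (Finset.mem_univ a)
  have hb : v b ^ 2 ≤ nsqV v :=
    Finset.single_le_sum (f := fun i => v i ^ 2) (fun i _ => sq_nonneg _) (Finset.mem_univ b)
  rw [abs_le]
  constructor <;> nlinarith [sq_nonneg (v a - v b), sq_nonneg (v a + v b)]

lemma wiener_step (N : ℕ) (hN : 0 < N) {σ : V3 → ℝ} (hreg : ContDiff ℝ 2 σ)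
    (hW : WienerCond N σ) (k : Fin 3 → ℤ) (hk : ¬ inGamma1 N k) (v : V3)
    (hv : ∀ m : Fin 3 → ℤ, dotP (xiN N (fun i => k i + N * m i)) v = 0 ∨
      fCoeffR N σ (xiN N (fun i => k i + N * m i)) = 0) : v = 0 := by
  by_contra hne
  have hpos := (hW k hk).dotProduct_mulVec_pos hne
  have hzero : (SigMat N σ (xiN N k)).mulVec v = 0 := by
    ext a
    simp only [Matrix.mulVec, dotProduct, SigMat, Matrix.of_apply, Pi.zero_apply]
    simp_rw [← tsum_mul_right]
    have hsum : ∀ b, Summable fun m : Fin 3 → ℤ =>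
        ((xiN N k a + 2 * π * (m a : ℝ)) * (xiN N k b + 2 * π * (m b : ℝ))
        / nsqV (fun i => xiN N k i + 2 * π * (m i : ℝ)))
      * Complex.normSq (fCoeffR N σ (fun i => xiN N k i + 2 * π * (m i : ℝ))) * v b := by
      intro b
      apply Summable.mul_right
      have hb := bessel N hN (f := fun x => (σ x : ℂ))
        (Complex.continuous_ofReal.comp hreg.continuous)
      have hinj : Function.Injective (fun (m : Fin 3 → ℤ) => (fun i => k i + (N:ℤ) * m i)) := by
        intro m m' h
        ext i
        have := congrFun h i
        have hNz : (N:ℤ) ≠ 0 := by exact_mod_cast hN.ne'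
        exact mul_left_cancel₀ hNz (add_left_cancel this)
      refine Summable.of_norm_bounded (hb.comp_injective hinj) fun m => ?_
      rw [norm_mul, xi_shift N hN]
      simp only [Function.comp]
      rw [Real.norm_of_nonneg (Complex.normSq_nonneg _)]
      refine mul_le_of_le_one_left (Complex.normSq_nonneg _) ?_
      rw [norm_div, Real.norm_of_nonneg (nsq_nonneg _)]
      refine div_le_one_of_le₀ ?_ (nsq_nonneg _)
      rw [← xi_shift N hN, Real.norm_eq_abs]
      exact mul_le_nsq (fun i => xiN N k i + 2 * π * (m i : ℝ)) a b
    rw [← Summable.tsum_finsetSum fun b _ => hsum b]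
    convert tsum_zero with m
    rcases hv m with h | h
    · rw [← xi_shift N hN] at h
      simp only [dotP] at h
      trans (xiN N k a + 2 * π * (m a : ℝ)) / nsqV (fun i => xiN N k i + 2 * π * (m i : ℝ))
        * Complex.normSq (fCoeffR N σ (fun i => xiN N k i + 2 * π * (m i : ℝ))) *
        ∑ i, (xiN N k i + 2 * π * (m i : ℝ)) * v i
      · rw [Finset.mul_sum]
        exact Finset.sum_congr rfl fun i _ => by ring
      · rw [h, mul_zero]
    · simp [xi_shift N hN, h]
  rw [hzero] at hpos
  simp at hpos

lemma hatK_shift (N : ℕ) (hN : 0 < N) (κ : GammaIdx N → V3) (k m : Fin 3 → ℤ) (a : Fin 3) :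
    hatK N κ (xiN N (fun i => k i + N * m i)) a = hatK N κ (xiN N k) a := by
  unfold hatK
  refine Finset.sum_congr rfl fun n _ => ?_
  congr 1
  show ex _ _ = ex _ _
  rw [← xi_shift N hN, show (fun i => xiN N k i + 2 * π * (m i : ℝ)) =
    xiN N k + (fun i => 2 * π * (m i : ℝ)) from rfl, ex_add_left]
  rw [show ex (fun i => 2 * π * (m i : ℝ)) (embG n) = 1 from ?_, mul_one]
  unfold ex
  rw [Complex.exp_eq_one_iff]
  refine ⟨∑ i, m i * (n i : ℕ), ?_⟩
  simp only [dotP, embG, Fin.sum_univ_three]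
  push_cast
  ring

lemma dual_summable (N : ℕ) (hN : 0 < N) {f : V3 → ℝ} (hf : Continuous f) :
    Summable fun k : Fin 3 → ℤ => if k = 0 then 0 else
      Complex.normSq (fCoeffR N f (xiN N k)) / nsqV (xiN N k) := by
  have hNr : (0 : ℝ) < N := by exact_mod_cast hN
  have hb := bessel N hN (f := fun x => (f x : ℂ)) (Complex.continuous_ofReal.comp hf)
  refine Summable.of_norm_bounded (hb.mul_right (((2 * π / N) ^ 2)⁻¹)) fun k => ?_
  split_ifs with hk
  · simp only [norm_zero]
    exact mul_nonneg (Complex.normSq_nonneg _) (by positivity)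
  · rw [Real.norm_of_nonneg (div_nonneg (Complex.normSq_nonneg _) (nsq_nonneg _)), div_eq_mul_inv]
    refine mul_le_mul_of_nonneg_left ?_ (Complex.normSq_nonneg _)
    obtain ⟨i, hi⟩ := Function.ne_iff.1 hk
    have h1 : xiN N k i ^ 2 ≤ nsqV (xiN N k) :=
      Finset.single_le_sum (f := fun i => xiN N k i ^ 2) (fun i _ => sq_nonneg _)
        (Finset.mem_univ i)
    have hpi := Real.pi_pos
    refine inv_anti₀ (by positivity) (le_trans ?_ h1)
    simp only [xiN, mul_pow]
    refine le_mul_of_one_le_right (by positivity) ?_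
    have : 1 ≤ (k i) ^ 2 := by
      have : 0 < (k i)^2 := by
        have : k i ≠ 0 := hi
        positivity
      omega
    exact_mod_cast this

lemma xi_ne (N : ℕ) (hN : 0 < N) {k : Fin 3 → ℤ} (hk : k ≠ 0) : xiN N k ≠ 0 := by
  intro h
  apply hk
  ext i
  have := congrFun h i
  have hN' : (N : ℝ) ≠ 0 := by exact_mod_cast hN.ne'
  simpa [xiN, Real.pi_ne_zero, hN'] using this

lemma gradSq_nonneg (φ : V3 → ℂ) (x : V3) : 0 ≤ gradSq φ x :=
  Finset.sum_nonneg fun _ _ => Complex.normSq_nonneg _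

lemma const_of_grad (N : ℕ) (hN : 0 < N) {φ : V3 → ℂ} (hp : IsPerN N φ) (hφ : ContDiff ℝ 1 φ)
    (h : ∫ x in cubeN N, gradSq φ x = 0) : ∃ c : ℂ, ∀ x, φ x = c := by
  have hNr : (0 : ℝ) < N := by exact_mod_cast hN
  have hc : Continuous (gradSq φ) := by
    unfold gradSq
    refine continuous_finsetSum _ fun i _ => Complex.continuous_normSq.comp ?_
    exact (hφ.continuous_fderiv (by norm_num)).clm_apply continuous_const
  rw [integral_eq_zero_iff_of_nonneg (fun x => gradSq_nonneg φ x) (intOn N hc),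
    Measure.restrict_congr_set (cube_ae N)] at h
  have h2 : Set.EqOn (gradSq φ) 0 (Set.Icc (fun _ => (0:ℝ)) (fun _ => (N:ℝ))) := by
    refine Measure.eqOn_of_ae_eq h hc.continuousOn continuousOn_const ?_
    rw [← Set.pi_univ_Icc, interior_pi_set Set.finite_univ, closure_pi_set]
    simp only [interior_Icc]
    rw [closure_Ioo hNr.ne]
  have h3 : ∀ x, fderiv ℝ φ x = 0 := by
    intro x
    have hex := fun i => existsUnique_add_zsmul_mem_Ico hNr (x i) 0
    choose m hm _ using hex
    rw [← per_fderiv N hp x m]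
    have h4 := h2 (x := x + fun i => (N:ℝ) * (m i : ℝ)) (by
      apply cube_subset
      intro i
      have := hm i
      simp only [zsmul_eq_mul, zero_add] at this
      simpa [mul_comm] using this)
    have h5 := (Finset.sum_eq_zero_iff_of_nonneg (fun _ _ => Complex.normSq_nonneg _)).1 h4
    apply ContinuousLinearMap.coe_injective
    apply LinearMap.pi_ext'
    intro i
    ext
    have := h5 i (Finset.mem_univ i)
    simpa using this
  exact ⟨φ 0, fun x => is_const_of_fderiv_eq_zero (hφ.differentiable (by norm_num)) h3 x 0⟩

/-- the null space of the energy Hessian. -/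
theorem stmt8 (N : ℕ) (hN : 0 < N) (σ : V3 → ℝ) (e Z M : ℝ)
    (he : 0 < e) (hZ : 0 < Z) (hM : 0 < M)
    (hper : IsPerN N σ) (hreg : ContDiff ℝ 2 σ)
    (hint : (∫ x in cubeN N, σ x) = e * Z)
    (hJ : JelliumCond N σ) (hW : WienerCond N σ) (α : ℝ) (r : V3) :
    ∀ (φ : V3 → ℂ) (κ p : GammaIdx N → V3), IsPerN N φ → ContDiff ℝ 1 φ →
      (BformQ N σ e Z M α r φ κ p = 0 ↔
        (∃ c : ℂ, ∀ x : V3, φ x = c) ∧ (∃ s : V3, ∀ n : GammaIdx N, κ n = s) ∧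
          (∀ n : GammaIdx N, p n = 0)) := by
  have hNr : (0 : ℝ) < N := by exact_mod_cast hN
  intro φ κ p hpφ hφ
  constructor
  · intro hB
    have hcρ : Continuous (rho1F N σ e Z α r κ φ) := by
      unfold rho1F
      exact (cont_sigma1 N hreg r κ).sub (continuous_const.mul
        (Complex.continuous_re.comp (continuous_const.mul hφ.continuous)))
    have hnn : ∀ k : Fin 3 → ℤ, 0 ≤ (if k = 0 then 0 else
        Complex.normSq (fCoeffR N (rho1F N σ e Z α r κ φ) (xiN N k)) / nsqV (xiN N k)) := by
      intro k
      split_ifs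
      · exact le_rfl
      · exact div_nonneg (Complex.normSq_nonneg _) (nsq_nonneg _)
    have h1 : 0 ≤ ∫ x in cubeN N, gradSq φ x := integral_nonneg fun x => gradSq_nonneg φ x
    have h2 : 0 ≤ dualSum N (rho1F N σ e Z α r κ φ) := tsum_nonneg hnn
    have h3 : 0 ≤ ∑ n : GammaIdx N, nsqV (p n) := Finset.sum_nonneg fun n _ => nsq_nonneg _
    have c2 : 0 < (2 * (N : ℝ) ^ 3)⁻¹ := by positivity
    have c3 : 0 < (2 * M)⁻¹ := by positivity
    unfold BformQ at hB
    have m2 := mul_nonneg c2.le h2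
    have m3 := mul_nonneg c3.le h3
    have e1 : ∫ x in cubeN N, gradSq φ x = 0 := by linarith
    have e2 : dualSum N (rho1F N σ e Z α r κ φ) = 0 := by
      have : (2 * (N : ℝ) ^ 3)⁻¹ * dualSum N (rho1F N σ e Z α r κ φ) = 0 := by linarith
      exact (mul_eq_zero.1 this).resolve_left c2.ne'
    have e3 : ∑ n : GammaIdx N, nsqV (p n) = 0 := by
      have : (2 * M)⁻¹ * ∑ n : GammaIdx N, nsqV (p n) = 0 := by linarith
      exact (mul_eq_zero.1 this).resolve_left c3.ne'
    obtain ⟨c, hc⟩ := const_of_grad N hN hpφ hφ e1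
    refine ⟨⟨c, hc⟩, ?_, ?_⟩
    · have hz : ∀ k : Fin 3 → ℤ, k ≠ 0 →
          (∑ a, (xiN N k a : ℂ) * hatK N κ (xiN N k) a) = 0 ∨ fCoeffR N σ (xiN N k) = 0 := by
        intro k hk
        have hs := (dual_summable N hN hcρ).hasSum
        unfold dualSum at e2
        rw [e2] at hs
        have := congrFun ((hasSum_zero_iff_of_nonneg hnn).1 hs) k
        simp only [if_neg hk, Pi.zero_apply] at this
        have hq : nsqV (xiN N k) ≠ 0 := fun h => xi_ne N hN hk (nsq_eq_zero h)
        have h0 := Complex.normSq_eq_zero.1 ((div_eq_zero_iff.1 this).resolve_right hq)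
        rw [coeff_rho1 N hN hper hreg e Z α r κ c φ hc k hk] at h0
        have hI : Complex.I * ex (xiN N k) r ≠ 0 := mul_ne_zero Complex.I_ne_zero (ex_ne _ _)
        exact mul_eq_zero.1 ((mul_eq_zero.1 h0).resolve_left hI)
      have hK : ∀ k, ¬ inGamma1 N k → ∀ a, hatK N κ (xiN N k) a = 0 := by
        intro k hk
        have hne : ∀ m : Fin 3 → ℤ, (fun i => k i + (N : ℤ) * m i) ≠ 0 := by
          intro m h
          apply hk
          intro i
          have := congrFun h i
          exact ⟨-m i, by simp at this; linarith⟩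
        have hre := wiener_step N hN hreg hW k hk (fun a => (hatK N κ (xiN N k) a).re) (by
          intro m
          refine (hz _ (hne m)).imp_left fun h => ?_
          have := congrArg Complex.re h
          simp only [hatK_shift N hN] at this
          simpa [dotP] using this)
        have him := wiener_step N hN hreg hW k hk (fun a => (hatK N κ (xiN N k) a).im) (by
          intro m
          refine (hz _ (hne m)).imp_left fun h => ?_
          have := congrArg Complex.im h
          simp only [hatK_shift N hN] at this
          simpa [dotP] using this)
        intro a
        exact Complex.ext (congrFun hre a) (congrFun him a)
      exact ⟨κ (fun _ => ⟨0, hN⟩), fun n => kappa_const N hN κ hK n _⟩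
    · intro n
      exact nsq_eq_zero ((Finset.sum_eq_zero_iff_of_nonneg
        (fun n _ => nsq_nonneg (p n))).1 e3 n (Finset.mem_univ n))
  · rintro ⟨⟨c, hc⟩, ⟨s, hs⟩, hp0⟩
    have e1 : ∀ x, gradSq φ x = 0 := by
      intro x
      have : φ = fun _ => c := funext hc
      simp [gradSq, this]
    have e2 : dualSum N (rho1F N σ e Z α r κ φ) = 0 := by
      unfold dualSum
      convert tsum_zero with k
      split_ifs with hk
      · rfl
      · rw [coeff_rho1 N hN hper hreg e Z α r κ c φ hc k hk]
        by_cases hg : inGamma1 N k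
        · choose m hm using hg
          have hm0 : m ≠ 0 := by
            rintro rfl
            apply hk
            ext i
            simp [hm i]
          have hx : xiN N k = fun i => 2 * π * (m i : ℝ) := by
            ext i
            simp only [xiN, hm i]
            push_cast
            field_simp
          have := hJ m hm0
          rw [← hx] at this
          simp [this]
        · simp [hatK_const N hN κ s hs k hg]
    simp [BformQ, e1, e2, hp0, nsqV]

end SPN
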